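/- For every k and every smooth function f: ℝ^m → S^k ℝ^m ⊗ Hom(V₁,V₂), the Casimir operator of the representation M ↦ L_{X^M} of sl(m+1,ℝ), computed with the κ-dual bases, is the zero-order operator with constant coefficients given by C₀: Σ_{i=1}^m [L_{X^{eᵢ}}(L_{X^{εⁱ}}f) + L_{X^{εⁱ}}(L_{X^{eᵢ}}f)] + (1/(2m))·L_{X^E}(L_{X^E}f) + Σ_s L_{X^{h_s}}(L_{X^{h_s^*}}f) = (1/2)·σ^(k)(Id)f + (1/(2m))·σ^(k)(Id)(σ^(k)(Id)f) + Σ_s σ^(k)(ψ(h_s))(σ^(k)(ψ(h_s^*))f), where the right-hand side is applied pointwise. -/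

import Mathlib

open scoped BigOperators
noncomputable section
namespace ProjQuant

/-- `ℝ^m`. -/
abbrev Rm (m : ℕ) := Fin m → ℝ

/-- The index set for `(m+1) × (m+1)` matrices, split into blocks. -/
abbrev Idx (m : ℕ) := Sum (Fin m) Unit

/-- `gl(m,ℝ)`, realized as continuous linear endomorphisms of `ℝ^m`. -/
abbrev GLm (m : ℕ) := (Fin m → ℝ) →L[ℝ] (Fin m → ℝ)

/-- `ℝ^{m*}`. -/
abbrev Dualm (m : ℕ) := (Fin m → ℝ) →L[ℝ] ℝ

/-- The vector field `X^M` on `ℝ^m` attached to a matrix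
`M = [[A, v], [ξ, a]] ∈ sl(m+1,ℝ)`, namely `X^M(x) = -v - A x + a x + ξ(x) x`. -/
def projVF (m : ℕ) (M : Matrix (Idx m) (Idx m) ℝ) : Rm m → Rm m := fun x i =>
  -(M (Sum.inl i) (Sum.inr ())) - (∑ j, M (Sum.inl i) (Sum.inl j) * x j)
    + M (Sum.inr ()) (Sum.inr ()) * x i
    + (∑ j, M (Sum.inr ()) (Sum.inl j) * x j) * x i

/-- The Lie derivative of a `V`-valued function along a vector field `X`, with respect to a
representation `σ` of `gl(m,ℝ)` on `V`:  `(L_X f)(x) = Df(x)[X(x)] - σ(DX(x))(f(x))`. -/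
def lieD (m : ℕ) {V : Type} [NormedAddCommGroup V] [NormedSpace ℝ V]
    (σ : GLm m → V → V) (X : Rm m → Rm m) (f : Rm m → V) : Rm m → V :=
  fun x => fderiv ℝ f x (X x) - σ (fderiv ℝ X x) (f x)

/-- `σ` is a Lie algebra representation of `gl(m,ℝ)`. -/
def IsLieRep (m : ℕ) {V : Type} [NormedAddCommGroup V] [NormedSpace ℝ V]
    (σ : GLm m →ₗ[ℝ] (V →L[ℝ] V)) : Prop :=
  ∀ A B : GLm m, σ (A ∘L B - B ∘L A) = σ A ∘L σ B - σ B ∘L σ A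


/-- Iterated Lie derivative along the constant fields `X^{hᵢ} = -hᵢ`, outermost first. -/
def lieItC (m : ℕ) {V : Type} [NormedAddCommGroup V] [NormedSpace ℝ V]
    (σ : GLm m → V → V) : (k : ℕ) → (Fin k → Rm m) → (Rm m → V) → (Rm m → V)
  | 0, _, f => f
  | (k+1), v, f => lieD m σ (fun _ => -(v 0)) (lieItC m σ k (fun j => v j.succ) f)

section Symbols

variable (m : ℕ) (V₁ V₂ : Type)
  [NormedAddCommGroup V₁] [NormedSpace ℝ V₁] [NormedAddCommGroup V₂] [NormedSpace ℝ V₂]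

/-- The model for `S^k ℝ^m ⊗ Hom(V₁,V₂)`: multilinear maps on `k` copies of `ℝ^{m*}`
with values in `Hom(V₁,V₂)` (symbols of degree `k` are the symmetric ones). -/
abbrev Symb (k : ℕ) := ContinuousMultilinearMap ℝ (fun _ : Fin k => Dualm m) (V₁ →L[ℝ] V₂)

/-- The decomposable tensor `h₁ ⊗ ⋯ ⊗ h_k ⊗ A` in the model. -/
def pureT {k : ℕ} (v : Fin k → Rm m) (A : V₁ →L[ℝ] V₂) : Symb m V₁ V₂ k :=
  (ContinuousMultilinearMap.mkPiRing ℝ (Fin k) A).compContinuousLinearMap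
    (fun i => ContinuousLinearMap.apply ℝ ℝ (v i))

/-- The symmetric product `h₁ ∨ ⋯ ∨ h_k ⊗ A` in the model. -/
def symT {k : ℕ} (v : Fin k → Rm m) (A : V₁ →L[ℝ] V₂) : Symb m V₁ V₂ k :=
  ∑ ν : Equiv.Perm (Fin k), pureT m V₁ V₂ (v ∘ ν) A

/-- The subspace of the model corresponding to `S^k ℝ^m ⊗ Hom(V₁,V₂)` itself:
the span of the symmetric products. -/
def spanGen (k : ℕ) : Submodule ℝ (Symb m V₁ V₂ k) :=
  Submodule.span ℝ {T | ∃ (v : Fin k → Rm m) (A : V₁ →L[ℝ] V₂), T = symT m V₁ V₂ v A}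

/-- The rank-one endomorphism `u ⊗ h : x ↦ h(x) • u` of `ℝ^m`. -/
def rkOne (u : Rm m) (h : Dualm m) : GLm m := h.smulRight u

variable (σ₁ : GLm m →ₗ[ℝ] (V₁ →L[ℝ] V₁)) (σ₂ : GLm m →ₗ[ℝ] (V₂ →L[ℝ] V₂))

/-- The representation `σ^{(k)}` of `gl(m,ℝ)` on `S^k ℝ^m ⊗ Hom(V₁,V₂)`, determined by
`σ^{(k)}(B)(h₁∨⋯∨h_k ⊗ A) = Σᵢ h₁∨⋯∨(B hᵢ)∨⋯∨h_k ⊗ A + h₁∨⋯∨h_k ⊗ (σ₂(B)∘A - A∘σ₁(B))`. -/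
def sigmaS {k : ℕ} (B : GLm m) (T : Symb m V₁ V₂ k) : Symb m V₁ V₂ k :=
  (∑ t : Fin k, T.compContinuousLinearMap
    (fun s => if s = t then (ContinuousLinearMap.compL ℝ (Rm m) (Rm m) ℝ).flip B
      else ContinuousLinearMap.id ℝ (Dualm m)))
  + ((ContinuousLinearMap.compL ℝ V₁ V₂ V₂ (σ₂ B))
      - (ContinuousLinearMap.compL ℝ V₁ V₁ V₂).flip (σ₁ B)).compContinuousMultilinearMap T

/-- The `i`-th coordinate covector on `ℝ^m`. -/
def coordD (i : Fin m) : Dualm m := ContinuousLinearMap.proj i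

/-- The affine quantization (standard ordering): the full contraction of a degree-`k` symbol
with the `k`-th derivative, `Q_Aff(h₁∨⋯∨h_k ⊗ A)(f) = A(∂_{h₁} ⋯ ∂_{h_k} f)`. -/
def QAff {k : ℕ} (T : Rm m → Symb m V₁ V₂ k) (f : Rm m → V₁) : Rm m → V₂ :=
  fun x => (k.factorial : ℝ)⁻¹ • ∑ d : Fin k → Fin m,
    (T x (fun t => coordD m (d t))) (iteratedFDeriv ℝ k f x (fun t => Pi.single (d t) 1))

/-- The defining property of the map `γ(h) : S^{k+1} ℝ^m ⊗ Hom(V₁,V₂) → S^k ℝ^m ⊗ Hom(V₁,V₂)`,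
for `h ∈ ℝ^{m*} ≅ 𝔤₁`:
`γ(h)(h₁∨⋯∨h_{k+1} ⊗ A) = Σᵢ h₁∨⋯(omit hᵢ)⋯∨h_{k+1} ⊗ (A ∘ σ₁(hᵢ⊗h + h(hᵢ)·Id))`
`- Σᵢ Σ_{j<i} h₁∨⋯(omit hⱼ,hᵢ)⋯∨h_{k+1} ∨ (h(hⱼ)·hᵢ + h(hᵢ)·hⱼ) ⊗ A`. -/
def gammaProp {k : ℕ}
    (γ : Dualm m → (Symb m V₁ V₂ (k+1) →ₗ[ℝ] Symb m V₁ V₂ k)) : Prop :=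
  ∀ (h : Dualm m) (v : Fin (k+1) → Rm m) (A : V₁ →L[ℝ] V₂),
    γ h (symT m V₁ V₂ v A) =
      (∑ i : Fin (k+1), symT m V₁ V₂ (i.removeNth v)
        (A.comp (σ₁ (rkOne m (v i) h + h (v i) • ContinuousLinearMap.id ℝ (Rm m)))))
      - ∑ i : Fin (k+1), ∑ j : Fin k,
          if (i.succAbove j : ℕ) < (i : ℕ) then
            symT m V₁ V₂ (i.removeNth (Function.update v (i.succAbove j)
              (h (v (i.succAbove j)) • v i + h (v i) • v (i.succAbove j)))) A
          else 0

/-- The model for `⊕_{k=0}^K S^k ℝ^m ⊗ Hom(V₁,V₂)`. -/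
abbrev SymbT (K : ℕ) := ∀ k : Fin (K+1), Symb m V₁ V₂ (k : ℕ)

/-- The degree-wise representation `⊕_k σ^{(k)}` on `⊕_{k=0}^K S^k ℝ^m ⊗ Hom(V₁,V₂)`. -/
def sigmaT {K : ℕ} (B : GLm m) (T : SymbT m V₁ V₂ K) : SymbT m V₁ V₂ K :=
  fun k => sigmaS m V₁ V₂ σ₁ σ₂ B (T k)

/-- The extension of a family `γ` to `⊕_{k=0}^K S^k ℝ^m ⊗ Hom(V₁,V₂)` (lowering degree). -/
def gTot {K : ℕ} (γf : ∀ k : ℕ, Dualm m → (Symb m V₁ V₂ (k+1) →ₗ[ℝ] Symb m V₁ V₂ k))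
    (h : Dualm m) (T : SymbT m V₁ V₂ K) : SymbT m V₁ V₂ K :=
  fun k => if hk : (k : ℕ) + 1 < K + 1 then γf (k : ℕ) h (T ⟨(k : ℕ) + 1, hk⟩) else 0


/-- The action `ρ^{(k)}(a) = S^k a ⊗ (Φ ↦ ρ₂(a)∘Φ∘ρ₁(a)⁻¹)` of `GL(m,ℝ)` on
`S^k ℝ^m ⊗ Hom(V₁,V₂)`, in the model. -/
def rhoK {k : ℕ} (a : (Fin m → ℝ) ≃L[ℝ] (Fin m → ℝ)) (r₁ : V₁ ≃L[ℝ] V₁) (r₂ : V₂ ≃L[ℝ] V₂)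
    (T : Symb m V₁ V₂ k) : Symb m V₁ V₂ k :=
  ((ContinuousLinearMap.compL ℝ V₁ V₂ V₂ (r₂ : V₂ →L[ℝ] V₂)) ∘L
    ((ContinuousLinearMap.compL ℝ V₁ V₁ V₂).flip
      ((r₁.symm : V₁ →L[ℝ] V₁)))).compContinuousMultilinearMap
    (T.compContinuousLinearMap
      (fun _ => (ContinuousLinearMap.compL ℝ (Rm m) (Rm m) ℝ).flip
        (a : (Fin m → ℝ) →L[ℝ] (Fin m → ℝ))))

end Symbols

section Matrices

variable (m : ℕ)

/-- The element of `𝔤₁ ⊂ sl(m+1,ℝ)` with `ξ`-block the covector `h`. -/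
def hMat (h : Dualm m) : Matrix (Idx m) (Idx m) ℝ :=
  Matrix.fromBlocks 0 0 (Matrix.of fun _ j => h (Pi.single j 1)) 0

/-- The element of `𝔤₋₁ ⊂ sl(m+1,ℝ)` with `v`-block the vector `X`. -/
def XMat (X : Rm m) : Matrix (Idx m) (Idx m) ℝ :=
  Matrix.fromBlocks 0 (Matrix.of fun i _ => X i) 0 0

/-- The lift `B̃ ∈ 𝔤₀ ⊂ sl(m+1,ℝ)` of `B ∈ gl(m,ℝ)`, with `ψ(B̃) = B`. -/
def BTilde (B : GLm m) : Matrix (Idx m) (Idx m) ℝ :=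
  Matrix.fromBlocks
    (LinearMap.toMatrix' (B : (Fin m → ℝ) →ₗ[ℝ] (Fin m → ℝ))
      - ((LinearMap.trace ℝ (Rm m) (B : (Fin m → ℝ) →ₗ[ℝ] (Fin m → ℝ))) / ((m : ℝ) + 1)) • 1)
    0 0
    (Matrix.of fun _ _ => -(LinearMap.trace ℝ (Rm m) (B : (Fin m → ℝ) →ₗ[ℝ] (Fin m → ℝ))) / ((m : ℝ) + 1))

/-- The map `ψ : 𝔤₀ → gl(m,ℝ) : [[A,0],[0,a]] ↦ A - a·Id`. -/
def psiC (M : Matrix (Idx m) (Idx m) ℝ) : GLm m :=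
  LinearMap.toContinuousLinearMap
    ((Matrix.of fun i j => M (Sum.inl i) (Sum.inl j)).mulVecLin
      - M (Sum.inr ()) (Sum.inr ()) • LinearMap.id)

/-- The basis `(eᵢ)` of `𝔤₋₁`, corresponding to the standard basis of `ℝ^m`. -/
def eMat (i : Fin m) : Matrix (Idx m) (Idx m) ℝ := XMat m (Pi.single i 1)

/-- The covector `εⁱ = (1/(2(m+1))) δⁱ ∈ ℝ^{m*}`. -/
def epsD (i : Fin m) : Dualm m := (1 / (2 * ((m : ℝ) + 1))) • coordD m i

/-- The basis `(εⁱ)` of `𝔤₁`, Killing-dual to `(eᵢ)`. -/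
def epsMat (i : Fin m) : Matrix (Idx m) (Idx m) ℝ := hMat m (epsD m i)

/-- The Euler element `E = diag(-1/(m+1), …, -1/(m+1), m/(m+1)) ∈ 𝔤₀`, with `ψ(E) = -Id`. -/
def EMat : Matrix (Idx m) (Idx m) ℝ :=
  Matrix.fromBlocks ((-(1 / ((m : ℝ) + 1))) • 1) 0 0 (Matrix.of fun _ _ => (m : ℝ) / ((m : ℝ) + 1))

/-- Membership in `𝔰 ≅ sl(m,ℝ) ⊂ 𝔤₀`: block diagonal with vanishing corner and traceless. -/
def inS (M : Matrix (Idx m) (Idx m) ℝ) : Prop :=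
  (∀ i, M (Sum.inl i) (Sum.inr ()) = 0) ∧ (∀ j, M (Sum.inr ()) (Sum.inl j) = 0) ∧
    M (Sum.inr ()) (Sum.inr ()) = 0 ∧ Matrix.trace M = 0

/-- Membership in `𝔤₋₁`: only the `v`-block is nonzero. -/
def inGm1 (M : Matrix (Idx m) (Idx m) ℝ) : Prop :=
  (∀ i j, M (Sum.inl i) (Sum.inl j) = 0) ∧ (∀ j, M (Sum.inr ()) (Sum.inl j) = 0) ∧
    M (Sum.inr ()) (Sum.inr ()) = 0

/-- Membership in `𝔤₁`: only the `ξ`-block is nonzero. -/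
def inG1 (M : Matrix (Idx m) (Idx m) ℝ) : Prop :=
  (∀ i j, M (Sum.inl i) (Sum.inl j) = 0) ∧ (∀ i, M (Sum.inl i) (Sum.inr ()) = 0) ∧
    M (Sum.inr ()) (Sum.inr ()) = 0

/-- Membership in `𝔤₀`: block diagonal. -/
def inG0 (M : Matrix (Idx m) (Idx m) ℝ) : Prop :=
  (∀ i, M (Sum.inl i) (Sum.inr ()) = 0) ∧ (∀ j, M (Sum.inr ()) (Sum.inl j) = 0)

/-- The Killing form of `sl(m+1,ℝ)`: `κ(M,N) = 2(m+1) tr(MN)`. -/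
def kappa (M N : Matrix (Idx m) (Idx m) ℝ) : ℝ := 2 * ((m : ℝ) + 1) * Matrix.trace (M * N)

end Matrices

section SymbolOperators

variable (m : ℕ) (V₁ V₂ : Type)
  [NormedAddCommGroup V₁] [NormedSpace ℝ V₁] [NormedAddCommGroup V₂] [NormedSpace ℝ V₂]
  (σ₁ : GLm m →ₗ[ℝ] (V₁ →L[ℝ] V₁)) (σ₂ : GLm m →ₗ[ℝ] (V₂ →L[ℝ] V₂))

/-- The operator `C₀ = (1/2)σ^{(k)}(Id) + (1/2m)σ^{(k)}(Id)² + Σ_s σ^{(k)}(ψ(h_s))∘σ^{(k)}(ψ(h_s^*))`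
on `S^k ℝ^m ⊗ Hom(V₁,V₂)`. -/
def C0op {k : ℕ} {n : ℕ} (hs hs' : Fin n → Matrix (Idx m) (Idx m) ℝ)
    (T : Symb m V₁ V₂ k) : Symb m V₁ V₂ k :=
  (1/2 : ℝ) • sigmaS m V₁ V₂ σ₁ σ₂ (ContinuousLinearMap.id ℝ (Rm m)) T
  + (1/(2*(m : ℝ))) • sigmaS m V₁ V₂ σ₁ σ₂ (ContinuousLinearMap.id ℝ (Rm m))
      (sigmaS m V₁ V₂ σ₁ σ₂ (ContinuousLinearMap.id ℝ (Rm m)) T)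
  + ∑ s, sigmaS m V₁ V₂ σ₁ σ₂ (psiC m (hs s)) (sigmaS m V₁ V₂ σ₁ σ₂ (psiC m (hs' s)) T)

/-- `C₀` acting degreewise on `⊕_{k=0}^K S^k ℝ^m ⊗ Hom(V₁,V₂)`. -/
def C0tot {K : ℕ} {n : ℕ} (hs hs' : Fin n → Matrix (Idx m) (Idx m) ℝ)
    (T : SymbT m V₁ V₂ K) : SymbT m V₁ V₂ K :=
  fun k => C0op m V₁ V₂ σ₁ σ₂ hs hs' (T k)

/-- The operator `𝓛_M = L_{X^M} + γ(ξ_M)` (flat curly Lie derivative) on functions with values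
in `⊕_{k=0}^K S^k ℝ^m ⊗ Hom(V₁,V₂)`, where `ξ_M` is the `𝔤₁`-component of `M`. -/
def curlyL {K : ℕ} (γf : ∀ k : ℕ, Dualm m → (Symb m V₁ V₂ (k+1) →ₗ[ℝ] Symb m V₁ V₂ k))
    (M : Matrix (Idx m) (Idx m) ℝ) (f : Rm m → SymbT m V₁ V₂ K) : Rm m → SymbT m V₁ V₂ K :=
  fun x => lieD m (fun B T => sigmaT m V₁ V₂ σ₁ σ₂ B T) (projVF m M) f x
    + gTot m V₁ V₂ γf (∑ j, M (Sum.inr ()) (Sum.inl j) • coordD m j) (f x)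

end SymbolOperators

section Curved

variable (m : ℕ) (P : Type) [NormedAddCommGroup P] [NormedSpace ℝ P]

/-- The invariant derivative `L_{ω^{-1}(Z)} f` along the `ω`-constant vector field `η Z`. -/
def LD (η : Matrix (Idx m) (Idx m) ℝ → P → P) (Z : Matrix (Idx m) (Idx m) ℝ)
    {V : Type} [NormedAddCommGroup V] [NormedSpace ℝ V] (f : P → V) : P → V :=
  fun u => fderiv ℝ f u (η Z u)

/-- The bracket compatibility satisfied by a normal Cartan connection: for `M ∈ 𝔤₀ ⊕ 𝔤₁` and
`N ∈ 𝔤₋₁`, `L_{ω^{-1}(M)} ∘ L_{ω^{-1}(N)} - L_{ω^{-1}(N)} ∘ L_{ω^{-1}(M)} = L_{ω^{-1}([M,N])}` on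
smooth vector-space-valued functions. -/
def BracketCompat (η : Matrix (Idx m) (Idx m) ℝ → P → P) : Prop :=
  ∀ (V : Type) [NormedAddCommGroup V] [NormedSpace ℝ V],
    ∀ f : P → V, ContDiff ℝ (⊤ : ℕ∞) f →
      ∀ M N : Matrix (Idx m) (Idx m) ℝ, Matrix.trace M = 0 → Matrix.trace N = 0 →
        (∀ i, M (Sum.inl i) (Sum.inr ()) = 0) → inGm1 m N →
        (LD m P η M (LD m P η N f) - LD m P η N (LD m P η M f)) = LD m P η (M * N - N * M) f

/-- Infinitesimal `G₀`-equivariance of `f : P → V` with respect to `σ`: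
`L_{ω^{-1}(B̃)} f = -σ(B) f` for all `B ∈ gl(m,ℝ)`. -/
def equivG0 (η : Matrix (Idx m) (Idx m) ℝ → P → P)
    {V : Type} [NormedAddCommGroup V] [NormedSpace ℝ V]
    (σ : GLm m → V → V) (f : P → V) : Prop :=
  ∀ B : GLm m, LD m P η (BTilde m B) f = fun u => -(σ B (f u))

/-- Iterated invariant derivatives along `𝔤₋₁`-constant fields. -/
def iterL (η : Matrix (Idx m) (Idx m) ℝ → P → P)
    {V : Type} [NormedAddCommGroup V] [NormedSpace ℝ V] :
    (k : ℕ) → (Fin k → Rm m) → (P → V) → (P → V)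
  | 0, _, f => f
  | (k+1), v, f => LD m P η (XMat m (v 0)) (iterL η k (fun j => v j.succ) f)

/-- The symmetrized iterated invariant differential `(∇^ω)^k f`, evaluated on
`(X₁, …, X_k) ∈ (ℝ^m)^k`. -/
def nabK (η : Matrix (Idx m) (Idx m) ℝ → P → P)
    {V : Type} [NormedAddCommGroup V] [NormedSpace ℝ V]
    (k : ℕ) (f : P → V) (v : Fin k → Rm m) : P → V :=
  fun u => (k.factorial : ℝ)⁻¹ • ∑ ν : Equiv.Perm (Fin k), iterL m P η k (v ∘ ν) f u

variable (V₁ V₂ : Type)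
  [NormedAddCommGroup V₁] [NormedSpace ℝ V₁] [NormedAddCommGroup V₂] [NormedSpace ℝ V₂]

/-- The curved quantization map: `Q_ω(T)(f)(u) = ⟨T(u), (∇^ω)^k f(u)⟩` (full contraction). -/
def Qom (η : Matrix (Idx m) (Idx m) ℝ → P → P) {k : ℕ}
    (T : P → Symb m V₁ V₂ k) (f : P → V₁) : P → V₂ :=
  fun u => (k.factorial : ℝ)⁻¹ • ∑ d : Fin k → Fin m,
    (T u (fun t => coordD m (d t))) (nabK m P η k f (fun t => Pi.single (d t) 1) u)


/-- The curved operator `N^ω f = -2 Σᵢ γ(εⁱ)(L_{ω^{-1}(eᵢ)} f)`. -/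
def Nom {K : ℕ} (γf : ∀ k : ℕ, Dualm m → (Symb m V₁ V₂ (k+1) →ₗ[ℝ] Symb m V₁ V₂ k))
    (η : Matrix (Idx m) (Idx m) ℝ → P → P) (f : P → SymbT m V₁ V₂ K) : P → SymbT m V₁ V₂ K :=
  fun u => (-2 : ℝ) • ∑ i : Fin m, gTot m V₁ V₂ γf (epsD m i)
    (LD m P η (XMat m (Pi.single i 1)) f u)

end Curved


section SigmaLinear

set_option synthInstance.maxHeartbeats 200000

variable (m : ℕ) (V₁ V₂ : Type)
  [NormedAddCommGroup V₁] [NormedSpace ℝ V₁] [NormedAddCommGroup V₂] [NormedSpace ℝ V₂]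
  (σ₁ : GLm m →ₗ[ℝ] (V₁ →L[ℝ] V₁)) (σ₂ : GLm m →ₗ[ℝ] (V₂ →L[ℝ] V₂))

lemma sigmaS_apply {k : ℕ} (B : GLm m) (T : Symb m V₁ V₂ k) (v : Fin k → Dualm m) :
    sigmaS m V₁ V₂ σ₁ σ₂ B T v =
      (∑ t : Fin k, T (Function.update v t ((v t).comp B)))
        + ((σ₂ B).comp (T v) - (T v).comp (σ₁ B)) := by
  simp only [sigmaS, add_apply, sum_apply,
    ContinuousMultilinearMap.compContinuousLinearMap_apply,
    ContinuousLinearMap.compContinuousMultilinearMap_coe, Function.comp_apply,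
    sub_apply, ContinuousLinearMap.compL_apply,
    ContinuousLinearMap.flip_apply]
  congr 1
  refine Finset.sum_congr rfl fun t _ => congrArg T (funext fun s => ?_)
  by_cases h : s = t
  · subst h; simp
  · simp [h]

/-- `sigmaS B` as a continuous linear map on the symbol space. -/
def sigmaCLM (k : ℕ) (B : GLm m) : Symb m V₁ V₂ k →L[ℝ] Symb m V₁ V₂ k :=
  (∑ t : Fin k, ContinuousMultilinearMap.compContinuousLinearMapL
    (fun s => if s = t then (ContinuousLinearMap.compL ℝ (Rm m) (Rm m) ℝ).flip B
      else ContinuousLinearMap.id ℝ (Dualm m)))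
  + ContinuousLinearMap.compContinuousMultilinearMapL ℝ (fun _ : Fin k => Dualm m) _ _
      ((ContinuousLinearMap.compL ℝ V₁ V₂ V₂ (σ₂ B))
        - (ContinuousLinearMap.compL ℝ V₁ V₁ V₂).flip (σ₁ B))

lemma sigmaCLM_apply (k : ℕ) (B : GLm m) (T : Symb m V₁ V₂ k) :
    sigmaCLM m V₁ V₂ σ₁ σ₂ k B T = sigmaS m V₁ V₂ σ₁ σ₂ B T := by
  simp [sigmaCLM, sigmaS, sum_apply]

lemma sigmaS_add {k : ℕ} (A B : GLm m) (T : Symb m V₁ V₂ k) :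
    sigmaS m V₁ V₂ σ₁ σ₂ (A + B) T =
      sigmaS m V₁ V₂ σ₁ σ₂ A T + sigmaS m V₁ V₂ σ₁ σ₂ B T := by
  ext1 v
  simp only [sigmaS_apply, add_apply, ContinuousLinearMap.comp_add, map_add,
    ContinuousMultilinearMap.map_update_add, Finset.sum_add_distrib,
    ContinuousLinearMap.add_comp]
  abel

lemma sigmaS_smul {k : ℕ} (c : ℝ) (B : GLm m) (T : Symb m V₁ V₂ k) :
    sigmaS m V₁ V₂ σ₁ σ₂ (c • B) T = c • sigmaS m V₁ V₂ σ₁ σ₂ B T := by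
  ext1 v
  simp only [sigmaS_apply, smul_apply, ContinuousLinearMap.comp_smul, map_smul,
    ContinuousMultilinearMap.map_update_smul, ContinuousLinearMap.smul_comp, smul_add, smul_sub,
    Finset.smul_sum]

end SigmaLinear

section OperatorFamily

variable {m : ℕ} {V : Type} [NormedAddCommGroup V] [NormedSpace ℝ V]

/-- A linear family of continuous operators indexed by `gl(m,ℝ)`, as a continuous linear map. -/
def opFamily (L : GLm m → V →L[ℝ] V) (hadd : ∀ A B v, L (A + B) v = L A v + L B v)
    (hsmul : ∀ (c : ℝ) B v, L (c • B) v = c • L B v) : GLm m →L[ℝ] (V →L[ℝ] V) :=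
  LinearMap.toContinuousLinearMap
    { toFun := L
      map_add' := fun A B => ContinuousLinearMap.ext (hadd A B)
      map_smul' := fun c B => ContinuousLinearMap.ext (hsmul c B) }

end OperatorFamily

section LieDerivative

variable {m : ℕ} {V : Type} [NormedAddCommGroup V] [NormedSpace ℝ V]
  (S : GLm m →L[ℝ] (V →L[ℝ] V))

/-- The second-order expansion of an iterated Lie derivative. -/
lemma lieD_lieD {X Y : Rm m → Rm m} {X' : GLm m} {Y' : Rm m → GLm m} {Y'' : Rm m →L[ℝ] GLm m}
    {f : Rm m → V} (hf : ContDiff ℝ (⊤ : ℕ∞) f) {x : Rm m}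
    (hX : HasFDerivAt X X' x) (hY : ∀ y, HasFDerivAt Y (Y' y) y) (hY' : HasFDerivAt Y' Y'' x) :
    lieD m (fun B T => S B T) X (lieD m (fun B T => S B T) Y f) x =
      fderiv ℝ (fderiv ℝ f) x (X x) (Y x) + fderiv ℝ f x (Y' x (X x))
        - S (Y'' (X x)) (f x) - S (Y' x) (fderiv ℝ f x (X x))
        - S X' (fderiv ℝ f x (Y x)) + S X' (S (Y' x) (f x)) := by
  have h1 : HasFDerivAt f (fderiv ℝ f x) x :=
    (hf.differentiable (by simp)).differentiableAt.hasFDerivAt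
  have h2 : HasFDerivAt (fderiv ℝ f) (fderiv ℝ (fderiv ℝ f) x) x :=
    ((hf.fderiv_right (m := (⊤ : ℕ∞)) (by simp)).differentiable
      (by simp)).differentiableAt.hasFDerivAt
  have hg : lieD m (fun B T => S B T) Y f =
      fun y => fderiv ℝ f y (Y y) - S (Y' y) (f y) := by
    funext y
    simp only [lieD, (hY y).fderiv]
  have h3 := (h2.clm_apply (hY x)).sub ((S.hasFDerivAt.comp x hY').clm_apply h1)
  rw [hg]
  unfold lieD
  rw [hX.fderiv]
  erw [h3.fderiv]
  simp only [sub_apply, add_apply,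
    ContinuousLinearMap.comp_apply, ContinuousLinearMap.flip_apply, map_sub, Function.comp_apply]
  abel

end LieDerivative

section Fields

variable (m : ℕ)

lemma projVF_eMat (i : Fin m) : projVF m (eMat m i) = fun _ => -(Pi.single i 1) := by
  funext x j
  simp [projVF, eMat, XMat]

lemma projVF_epsMat (i : Fin m) :
    projVF m (epsMat m i) = fun x => ((1 / (2 * ((m : ℝ) + 1))) * x i) • x := by
  funext x j
  simp [projVF, epsMat, hMat, epsD, coordD, Pi.single_apply]

lemma projVF_EMat : projVF m (EMat m) = fun x => ContinuousLinearMap.id ℝ (Rm m) x := by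
  funext x j
  have h : (m : ℝ) + 1 ≠ 0 := by positivity
  simp [projVF, EMat, Matrix.one_apply]
  field_simp
  ring

lemma psiC_apply (M : Matrix (Idx m) (Idx m) ℝ) (x : Rm m) :
    psiC m M x = Matrix.mulVec M.toBlocks₁₁ x - M (Sum.inr ()) (Sum.inr ()) • x := by
  simp [psiC, Matrix.toBlocks₁₁]

lemma projVF_of_inS {M : Matrix (Idx m) (Idx m) ℝ} (hM : inS m M) :
    projVF m M = fun x => (-psiC m M) x := by
  funext x i
  obtain ⟨h1, h2, h3, -⟩ := hM
  simp [projVF, psiC_apply, h1, h2, h3, Matrix.mulVec, dotProduct, Matrix.toBlocks₁₁]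

/-- The second derivative of the quadratic field `x ↦ (c xᵢ) x`. -/
def quadD (c : ℝ) (i : Fin m) : Rm m →L[ℝ] GLm m :=
  (c • (ContinuousLinearMap.proj i : Dualm m)).smulRight (ContinuousLinearMap.id ℝ (Rm m))
    + ContinuousLinearMap.smulRightL ℝ (Rm m) (Rm m) (c • (ContinuousLinearMap.proj i : Dualm m))

lemma quadD_apply (c : ℝ) (i : Fin m) (x : Rm m) :
    quadD m c i x = (c * x i) • ContinuousLinearMap.id ℝ (Rm m)
      + c • rkOne m x (coordD m i) := by
  ext1 y
  simp [quadD, rkOne, coordD, smul_smul]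

lemma hasFDerivAt_quad (c : ℝ) (i : Fin m) (x : Rm m) :
    HasFDerivAt (fun y : Rm m => (c * y i) • y) (quadD m c i x) x := by
  have h1 : HasFDerivAt (fun y : Rm m => c * y i)
      (c • (ContinuousLinearMap.proj i : Dualm m)) x :=
    (c • (ContinuousLinearMap.proj i : Dualm m)).hasFDerivAt
  exact h1.smul (hasFDerivAt_id x)

end Fields

section Casimir

variable (m : ℕ)

/-- The matrix unit `E_{ij} : x ↦ xⱼ eᵢ` as an element of `gl(m,ℝ)`. -/
def unitE (i j : Fin m) : GLm m := rkOne m (Pi.single i 1) (coordD m j)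

lemma unitE_apply (i j : Fin m) (x : Rm m) : unitE m i j x = x j • Pi.single i 1 := rfl

lemma coordD_apply (i : Fin m) (x : Rm m) : coordD m i x = x i := rfl

lemma rkOne_apply (u : Rm m) (h : Dualm m) (x : Rm m) : rkOne m u h x = h x • u := rfl

lemma rkOne_neg (u : Rm m) (h : Dualm m) : rkOne m (-u) h = -rkOne m u h := by
  ext1 y
  simp [rkOne]

lemma sum_unitE : ∑ i, unitE m i i = ContinuousLinearMap.id ℝ (Rm m) := by
  ext1 x
  funext l
  simp [unitE_apply, Pi.single_apply, Finset.sum_apply]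

lemma sum_smul_unitE (x : Rm m) (i : Fin m) :
    ∑ j, x j • unitE m j i = rkOne m x (coordD m i) := by
  ext1 y
  funext l
  simp [unitE_apply, rkOne, coordD_apply, Pi.single_apply, Finset.sum_apply, mul_comm]

/-- The embedding of `m × m` matrices as the upper left block. -/
def blockEmb (A : Matrix (Fin m) (Fin m) ℝ) : Matrix (Idx m) (Idx m) ℝ :=
  Matrix.fromBlocks A 0 0 0

lemma psiC_blockEmb_apply (A : Matrix (Fin m) (Fin m) ℝ) (x : Rm m) :
    psiC m (blockEmb m A) x = A.mulVec x := by
  simp [psiC_apply, blockEmb]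

lemma psiC_eq_sum {M : Matrix (Idx m) (Idx m) ℝ} (hM : inS m M) :
    psiC m M = ∑ i, ∑ j, M (Sum.inl i) (Sum.inl j) • unitE m i j := by
  ext1 x
  funext l
  simp [psiC_apply, hM.2.2.1, sum_apply, unitE_apply, Matrix.mulVec,
    dotProduct, Matrix.toBlocks₁₁, Pi.single_apply, Finset.sum_apply]

lemma kappa_blockEmb_single (i j : Fin m) (N : Matrix (Idx m) (Idx m) ℝ) :
    kappa m (blockEmb m (Matrix.single i j 1)) N =
      2 * ((m : ℝ) + 1) * N (Sum.inl j) (Sum.inl i) := by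
  simp [kappa, blockEmb, Matrix.trace, Matrix.mul_apply, Matrix.single_apply, ite_and]

lemma psiC_blockEmb_single (i j : Fin m) :
    psiC m (blockEmb m (Matrix.single i j 1)) = unitE m i j := by
  ext1 x
  funext l
  rw [psiC_blockEmb_apply]
  simp [unitE_apply, Matrix.single_mulVec, Function.update_apply, Pi.single_apply]

lemma psiC_blockEmb_one : psiC m (blockEmb m 1) = ContinuousLinearMap.id ℝ (Rm m) := by
  ext1 x
  simp [psiC_blockEmb_apply]

/-- `psiC` as a linear map. -/
def psiL : Matrix (Idx m) (Idx m) ℝ →ₗ[ℝ] GLm m where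
  toFun := psiC m
  map_add' A B := by
    ext1 x
    funext l
    simp [psiC_apply, Matrix.toBlocks₁₁, Matrix.mulVec, dotProduct, add_mul,
      Finset.sum_add_distrib]
    ring
  map_smul' c A := by
    ext1 x
    funext l
    simp [psiC_apply, Matrix.toBlocks₁₁, Matrix.mulVec, dotProduct, mul_assoc, Finset.mul_sum,
      mul_sub]

lemma inS_traceless (hm : 2 ≤ m) (A : Matrix (Fin m) (Fin m) ℝ) :
    inS m (blockEmb m A - (A.trace / m) • blockEmb m 1) := by
  have h : (m : ℝ) ≠ 0 := by positivity
  refine ⟨by simp [blockEmb], by simp [blockEmb], by simp [blockEmb], ?_⟩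
  simp [blockEmb, Matrix.trace, mul_div_cancel₀ _ h]

variable {m}

/-- Contraction of a bilinear map with the Casimir tensor of `sl(m,ℝ)`. -/
lemma sum_bilin_dual (hm : 2 ≤ m) {n : ℕ} {hs hs' : Fin n → Matrix (Idx m) (Idx m) ℝ}
    (hmem' : ∀ s, inS m (hs' s))
    (hcompl : ∀ Y, inS m Y → (∑ s, kappa m Y (hs' s) • hs s) = Y)
    {W : Type*} [AddCommGroup W] [Module ℝ W] (Φ : GLm m →ₗ[ℝ] GLm m →ₗ[ℝ] W) :
    ∑ s, Φ (psiC m (hs s)) (psiC m (hs' s)) =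
      (1 / (2 * ((m : ℝ) + 1))) • (∑ i, ∑ j, Φ (unitE m i j) (unitE m j i))
        - (1 / (2 * ((m : ℝ) + 1) * m)) •
          Φ (ContinuousLinearMap.id ℝ (Rm m)) (ContinuousLinearMap.id ℝ (Rm m)) := by
  have hm0 : (m : ℝ) ≠ 0 := by positivity
  have hm1 : (m : ℝ) + 1 ≠ 0 := by positivity
  have htr : ∀ s, ∑ i, hs' s (Sum.inl i) (Sum.inl i) = 0 := fun s => by
    have := (hmem' s).2.2.2
    simpa [Matrix.trace, (hmem' s).2.2.1] using this
  have key : ∀ i j, ∑ s, hs' s (Sum.inl j) (Sum.inl i) • psiC m (hs s) =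
      (1 / (2 * ((m : ℝ) + 1))) • (unitE m i j
        - (if i = j then (1 / (m : ℝ)) else 0) • ContinuousLinearMap.id ℝ (Rm m)) := by
    intro i j
    have h := congrArg (psiL m) (hcompl _ (inS_traceless m hm (Matrix.single i j 1)))
    have hk : ∀ s, kappa m (blockEmb m (Matrix.single i j 1)
        - ((Matrix.single i j (1 : ℝ)).trace / m) • blockEmb m 1) (hs' s) =
        2 * ((m : ℝ) + 1) * hs' s (Sum.inl j) (Sum.inl i) := by
      intro s
      rw [← kappa_blockEmb_single]
      have h1 : Matrix.trace (blockEmb m 1 * hs' s) = 0 := by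
        rw [← htr s]
        simp [blockEmb, Matrix.trace, Matrix.mul_apply, Matrix.one_apply]
      simp only [kappa, Matrix.sub_mul, Matrix.trace_sub, Matrix.smul_mul, Matrix.trace_smul, h1]
      simp
    simp only [hk, map_sum, map_smul, map_sub] at h
    change ∑ s, (2 * ((m : ℝ) + 1) * hs' s (Sum.inl j) (Sum.inl i)) • psiC m (hs s) =
      psiC m (blockEmb m (Matrix.single i j 1)) - _ • psiC m (blockEmb m 1) at h
    rw [psiC_blockEmb_single, psiC_blockEmb_one] at h
    have ht : (Matrix.single i j (1 : ℝ)).trace / m = if i = j then 1 / (m : ℝ) else 0 := by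
      by_cases hij : i = j
      · subst hij; simp
      · simp [hij, Matrix.trace_single_eq_of_ne]
    rw [ht] at h
    rw [← h, Finset.smul_sum]
    refine Finset.sum_congr rfl fun s _ => ?_
    rw [smul_smul]
    congr 1
    field_simp
  calc ∑ s, Φ (psiC m (hs s)) (psiC m (hs' s))
      = ∑ s, ∑ j, ∑ i, hs' s (Sum.inl j) (Sum.inl i) • Φ (psiC m (hs s)) (unitE m j i) := by
        refine Finset.sum_congr rfl fun s _ => ?_
        rw [psiC_eq_sum m (hmem' s)]
        simp only [map_sum, map_smul]
    _ = ∑ j, ∑ i, Φ (∑ s, hs' s (Sum.inl j) (Sum.inl i) • psiC m (hs s)) (unitE m j i) := by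
        rw [Finset.sum_comm]
        refine Finset.sum_congr rfl fun j _ => ?_
        rw [Finset.sum_comm]
        simp only [map_sum, map_smul, LinearMap.sum_apply, LinearMap.smul_apply]
    _ = _ := by
        simp only [key, map_smul, map_sub, LinearMap.smul_apply, LinearMap.sub_apply, smul_sub,
          Finset.sum_sub_distrib, ← Finset.smul_sum]
        simp only [ite_smul, zero_smul, Finset.sum_ite_eq', Finset.mem_univ, if_true]
        rw [← Finset.smul_sum, ← map_sum, sum_unitE, Finset.sum_comm]
        rw [smul_smul]
        congr 2
        field_simp

end Casimir

section CasimirFlat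

variable {m : ℕ} {V : Type} [NormedAddCommGroup V] [NormedSpace ℝ V]

lemma sum_smul_map_single {W : Type*} [AddCommGroup W] [Module ℝ W] (L : Rm m →ₗ[ℝ] W)
    (x : Rm m) : ∑ i, x i • L (Pi.single i 1) = L x := by
  conv_rhs => rw [pi_eq_sum_univ' x]
  simp [map_sum, map_smul]

/-- The flat Casimir operator for a general action `S` of `gl(m,ℝ)`. -/
lemma casimir_flat (hm : 2 ≤ m) {n : ℕ} {hs hs' : Fin n → Matrix (Idx m) (Idx m) ℝ}
    (hmem : ∀ s, inS m (hs s)) (hmem' : ∀ s, inS m (hs' s))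
    (hcompl : ∀ Y, inS m Y → (∑ s, kappa m Y (hs' s) • hs s) = Y)
    (S : GLm m →L[ℝ] (V →L[ℝ] V)) {f : Rm m → V} (hf : ContDiff ℝ (⊤ : ℕ∞) f) (x : Rm m) :
    (∑ i : Fin m,
        (lieD m (fun B T => S B T) (projVF m (eMat m i))
          (lieD m (fun B T => S B T) (projVF m (epsMat m i)) f) x
        + lieD m (fun B T => S B T) (projVF m (epsMat m i))
          (lieD m (fun B T => S B T) (projVF m (eMat m i)) f) x))
      + (1/(2*(m : ℝ))) • lieD m (fun B T => S B T) (projVF m (EMat m))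
          (lieD m (fun B T => S B T) (projVF m (EMat m)) f) x
      + ∑ s : Fin n, lieD m (fun B T => S B T) (projVF m (hs s))
            (lieD m (fun B T => S B T) (projVF m (hs' s)) f) x
    = (1/2 : ℝ) • S (ContinuousLinearMap.id ℝ (Rm m)) (f x)
      + (1/(2*(m : ℝ))) • S (ContinuousLinearMap.id ℝ (Rm m))
          (S (ContinuousLinearMap.id ℝ (Rm m)) (f x))
      + ∑ s, S (psiC m (hs s)) (S (psiC m (hs' s)) (f x)) := by
  have hm0 : (m : ℝ) ≠ 0 := by positivity
  have hm1 : (m : ℝ) + 1 ≠ 0 := by positivity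
  set c : ℝ := 1 / (2 * ((m : ℝ) + 1)) with hc
  set D := fderiv ℝ f x with hD
  set D2 := fderiv ℝ (fderiv ℝ f) x with hD2
  set I := ContinuousLinearMap.id ℝ (Rm m) with hI
  have hconst : ∀ (i : Fin m) (y : Rm m),
      HasFDerivAt (fun _ : Rm m => -(Pi.single i 1 : Rm m)) (0 : GLm m) y :=
    fun i y => hasFDerivAt_const _ y
  have h1 : ∀ i, lieD m (fun B T => S B T) (projVF m (eMat m i))
        (lieD m (fun B T => S B T) (projVF m (epsMat m i)) f) x =
      -(c • (x i • D2 (Pi.single i 1) x)) - c • (x i • D (Pi.single i 1)) - c • D x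
        + c • S I (f x) + c • S (unitE m i i) (f x) + c • (x i • S I (D (Pi.single i 1)))
        + c • S (rkOne m x (coordD m i)) (D (Pi.single i 1)) := by
    intro i
    rw [projVF_eMat, projVF_epsMat, ← hc, lieD_lieD S hf (hconst i x) (hasFDerivAt_quad m c i)
      (quadD m c i).hasFDerivAt]
    simp only [quadD_apply, ← hD, ← hD2, ← hI]
    simp [rkOne_neg, rkOne_apply, unitE, coordD_apply, smul_smul, hI]
    module
  have h2 : ∀ i, lieD m (fun B T => S B T) (projVF m (epsMat m i))
        (lieD m (fun B T => S B T) (projVF m (eMat m i)) f) x =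
      -(c • (x i • D2 x (Pi.single i 1))) + c • (x i • S I (D (Pi.single i 1)))
        + c • S (rkOne m x (coordD m i)) (D (Pi.single i 1)) := by
    intro i
    rw [projVF_eMat, projVF_epsMat, ← hc, lieD_lieD S hf (hasFDerivAt_quad m c i x) (hconst i)
      (hasFDerivAt_const (0 : GLm m) x)]
    simp only [quadD_apply, ← hD, ← hD2, ← hI]
    simp [smul_smul]
    module
  have h3 : lieD m (fun B T => S B T) (projVF m (EMat m))
          (lieD m (fun B T => S B T) (projVF m (EMat m)) f) x =
      D2 x x + D x - (2 : ℝ) • S I (D x) + S I (S I (f x)) := by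
    rw [projVF_EMat, lieD_lieD S hf I.hasFDerivAt (fun y => I.hasFDerivAt)
      (hasFDerivAt_const _ x)]
    simp only [← hD, ← hD2]
    simp [hI]
    module
  have h4 : ∀ s, lieD m (fun B T => S B T) (projVF m (hs s))
            (lieD m (fun B T => S B T) (projVF m (hs' s)) f) x =
      D2 (psiC m (hs s) x) (psiC m (hs' s) x) + D (psiC m (hs' s) (psiC m (hs s) x))
        - S (psiC m (hs' s)) (D (psiC m (hs s) x)) - S (psiC m (hs s)) (D (psiC m (hs' s) x))
        + S (psiC m (hs s)) (S (psiC m (hs' s)) (f x)) := by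
    intro s
    rw [projVF_of_inS m (hmem s), projVF_of_inS m (hmem' s),
      lieD_lieD S hf (-psiC m (hs s)).hasFDerivAt
      (fun y => (-psiC m (hs' s)).hasFDerivAt) (hasFDerivAt_const _ x)]
    simp only [← hD, ← hD2]
    simp
  let ev : GLm m →ₗ[ℝ] Rm m := (ContinuousLinearMap.apply ℝ (Rm m) x).toLinearMap
  let Sl : GLm m →ₗ[ℝ] V →ₗ[ℝ] V := (ContinuousLinearMap.coeLM ℝ).comp S.toLinearMap
  let D2l : Rm m →ₗ[ℝ] Rm m →ₗ[ℝ] V := (ContinuousLinearMap.coeLM ℝ).comp D2.toLinearMap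
  have c1 := sum_bilin_dual hm hmem' hcompl (D2l.compl₁₂ ev ev)
  have c2 := sum_bilin_dual hm hmem' hcompl
    (((LinearMap.mul ℝ (GLm m)).flip).compr₂ (D.toLinearMap.comp ev))
  have c3 := sum_bilin_dual hm hmem' hcompl ((Sl.compl₁₂ LinearMap.id (D.toLinearMap.comp ev)).flip)
  have c4 := sum_bilin_dual hm hmem' hcompl (Sl.compl₁₂ LinearMap.id (D.toLinearMap.comp ev))
  simp only [LinearMap.compl₁₂_apply, LinearMap.compr₂_apply, LinearMap.flip_apply,
    LinearMap.comp_apply, LinearMap.mul_apply', LinearMap.id_apply, ev, Sl, D2l,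
    ContinuousLinearMap.coeLM_apply, ContinuousLinearMap.coe_coe,
    ContinuousLinearMap.apply_apply, mul_apply_eq_comp, ← hc, ← hI] at c1 c2 c3 c4
  have a1 : ∑ i, x i • D2 (Pi.single i 1) x = D2 x x :=
    sum_smul_map_single (D2l.flip x) x
  have a2 : ∑ i, x i • D2 x (Pi.single i 1) = D2 x x :=
    sum_smul_map_single (D2l x) x
  have a3 : ∑ i, x i • D (Pi.single i 1) = D x := sum_smul_map_single D.toLinearMap x
  have b1 : ∑ i, ∑ j, D2 (unitE m i j x) (unitE m j i x) = D2 x x := by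
    rw [← a1]
    refine Finset.sum_congr rfl fun i _ => ?_
    have h : ∑ j, x j • D2 (Pi.single i 1) (Pi.single j 1) = D2 (Pi.single i 1) x :=
      sum_smul_map_single (D2l (Pi.single i 1)) x
    rw [← h, Finset.smul_sum]
    refine Finset.sum_congr rfl fun j _ => ?_
    simp only [unitE_apply, map_smul, smul_apply]
  have b2 : ∑ i, ∑ j, D (unitE m j i (unitE m i j x)) = (m : ℝ) • D x := by
    have : ∀ i j, D (unitE m j i (unitE m i j x)) = x j • D (Pi.single j 1) := by
      intro i j
      simp [unitE_apply]
    simp only [this, a3]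
    rw [Finset.sum_const, Finset.card_univ, Fintype.card_fin, Nat.cast_smul_eq_nsmul]
  have b3 : ∑ i, ∑ j, S (unitE m j i) (D (unitE m i j x)) =
      ∑ i, S (rkOne m x (coordD m i)) (D (Pi.single i 1)) := by
    refine Finset.sum_congr rfl fun i _ => ?_
    rw [← sum_smul_unitE]
    simp [unitE_apply]
  have b4 : ∑ i, ∑ j, S (unitE m i j) (D (unitE m j i x)) =
      ∑ i, S (rkOne m x (coordD m i)) (D (Pi.single i 1)) := by
    rw [Finset.sum_comm, b3]
  have a4 : ∑ i, x i • S I (D (Pi.single i 1)) = S I (D x) :=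
    sum_smul_map_single ((Sl I).comp D.toLinearMap) x
  have a5 : ∑ i, S (unitE m i i) (f x) = S I (f x) := by
    rw [hI, ← sum_unitE, map_sum, sum_apply]
  have hIx : I x = x := rfl
  simp only [hIx, b1, b2, b3, b4] at c1 c2 c3 c4
  simp only [h1, h2, h3, h4, Finset.sum_add_distrib, Finset.sum_sub_distrib,
    Finset.sum_neg_distrib, ← Finset.smul_sum, a1, a2, a3, a4, a5, c1, c2, c3, c4,
    Finset.sum_const, Finset.card_univ, Fintype.card_fin, ← Nat.cast_smul_eq_nsmul ℝ]
  rw [hc]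
  match_scalars <;> field_simp <;> ring

end CasimirFlat

/-- the Casimir operator of the representation `L` of `sl(m+1,ℝ)` on symbol-valued
functions is the zero-order operator
`C₀ = (1/2)σ^{(k)}(Id) + (1/2m)σ^{(k)}(Id)² + Σ_s σ^{(k)}(ψ(h_s))∘σ^{(k)}(ψ(h_s^*))`. -/
theorem statement12 (m : ℕ) (hm : 2 ≤ m)
    (V₁ V₂ : Type) [NormedAddCommGroup V₁] [NormedSpace ℝ V₁] [FiniteDimensional ℝ V₁]
    [NormedAddCommGroup V₂] [NormedSpace ℝ V₂] [FiniteDimensional ℝ V₂]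
    (σ₁ : GLm m →ₗ[ℝ] (V₁ →L[ℝ] V₁)) (hσ₁ : IsLieRep m σ₁)
    (σ₂ : GLm m →ₗ[ℝ] (V₂ →L[ℝ] V₂)) (hσ₂ : IsLieRep m σ₂)
    (n : ℕ) (hs hs' : Fin n → Matrix (Idx m) (Idx m) ℝ)
    (hmem : ∀ s, inS m (hs s)) (hmem' : ∀ s, inS m (hs' s))
    (hdual : ∀ s t, kappa m (hs s) (hs' t) = if s = t then 1 else 0)
    (hcompl : ∀ Y, inS m Y → (∑ s, kappa m Y (hs' s) • hs s) = Y)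
    (k : ℕ) (f : Rm m → Symb m V₁ V₂ k) (hf : ContDiff ℝ (⊤ : ℕ∞) f) (x : Rm m) :
    (∑ i : Fin m,
        (lieD m (fun B S => sigmaS m V₁ V₂ σ₁ σ₂ B S) (projVF m (eMat m i))
          (lieD m (fun B S => sigmaS m V₁ V₂ σ₁ σ₂ B S) (projVF m (epsMat m i)) f) x
        + lieD m (fun B S => sigmaS m V₁ V₂ σ₁ σ₂ B S) (projVF m (epsMat m i))
          (lieD m (fun B S => sigmaS m V₁ V₂ σ₁ σ₂ B S) (projVF m (eMat m i)) f) x))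
      + (1/(2*(m : ℝ))) • lieD m (fun B S => sigmaS m V₁ V₂ σ₁ σ₂ B S) (projVF m (EMat m))
          (lieD m (fun B S => sigmaS m V₁ V₂ σ₁ σ₂ B S) (projVF m (EMat m)) f) x
      + ∑ s : Fin n,
          lieD m (fun B S => sigmaS m V₁ V₂ σ₁ σ₂ B S) (projVF m (hs s))
            (lieD m (fun B S => sigmaS m V₁ V₂ σ₁ σ₂ B S) (projVF m (hs' s)) f) x
    = C0op m V₁ V₂ σ₁ σ₂ hs hs' (f x) := by
  have h := casimir_flat hm hmem hmem' hcompl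
    (opFamily (sigmaCLM m V₁ V₂ σ₁ σ₂ k)
      (fun A B T => by simp only [sigmaCLM_apply, sigmaS_add])
      (fun c B T => by simp only [sigmaCLM_apply, sigmaS_smul])) hf x
  have happ : ∀ B T, opFamily (sigmaCLM m V₁ V₂ σ₁ σ₂ k)
      (fun A B T => by simp only [sigmaCLM_apply, sigmaS_add])
      (fun c B T => by simp only [sigmaCLM_apply, sigmaS_smul]) B T =
      sigmaS m V₁ V₂ σ₁ σ₂ B T := fun B T => sigmaCLM_apply m V₁ V₂ σ₁ σ₂ k B T
  simp only [happ] at h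
  exact h

end ProjQuant
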